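/- arXiv:1809.05543 — 2 statements merged into one kernel-verified Lean document; each statement's English description precedes it below -/
import Mathlib

section
/- Let X, Y, Z be complete sub-σ-fields of a probability space (Ω, M, P) with Y ⊆ X and X ∨ Z countably generated up to negligible sets. If X ∨ Z is conditionally non-atomic given Y ∨ Z, then X is conditionally non-atomic given Y. -/
open MeasureTheory ProbabilityTheory

/-- The σ-field `0_Λ` of `P`-trivial events: events of the ambient σ-field `m` whose
probability is `0` or `1`. -/
def zeroLambda {Ω : Type*} (m : MeasurableSpace Ω) (P : @MeasureTheory.Measure Ω m) :
    MeasurableSpace Ω :=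
  MeasurableSpace.generateFrom {A : Set Ω | MeasurableSet[m] A ∧ (P A = 0 ∨ P A = 1)}

/-- `σ̄(ξ)`: the smallest complete sub-σ-field making `ξ` measurable, i.e.
`σ(ξ) ∨ 0_Λ`. -/
def sigmaBar {Ω : Type*} {E : Type*} [MeasurableSpace E] (m : MeasurableSpace Ω)
    (P : @MeasureTheory.Measure Ω m) (ξ : Ω → E) : MeasurableSpace Ω :=
  MeasurableSpace.comap ξ inferInstance ⊔ zeroLambda m P

/-- `X` is conditionally non-atomic given `Y` (for `Y ⊆ X`, `X` essentially separable):
there is an `X`-measurable random variable `Z` with values in `[0,1]`, uniform law,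
independent of `Y`, such that `Y ∨ σ̄(Z) = X`. -/
def CondNonAtomic {Ω : Type*} (m : MeasurableSpace Ω) (P : @MeasureTheory.Measure Ω m)
    (X Y : MeasurableSpace Ω) : Prop :=
  ∃ Z : Ω → ℝ, Measurable[X] Z ∧ (∀ ω, Z ω ∈ Set.Icc (0 : ℝ) 1) ∧
    @MeasureTheory.Measure.map Ω ℝ m _ Z P = volume.restrict (Set.Icc (0 : ℝ) 1) ∧
    Indep (MeasurableSpace.comap Z inferInstance) Y P ∧
    Y ⊔ sigmaBar m P Z = X

open Set Filter Topology

theorem continuous_cdf_of_nullSingletonClass (ρ : Measure ℝ) [IsProbabilityMeasure ρ]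
    [NullSingletonClass ρ] :
    Continuous (cdf ρ) := by
  rw [continuous_iff_continuousAt]
  intro x
  have h1 : ContinuousWithinAt (cdf ρ) (Ioi x) x :=
    ((cdf ρ).right_continuous x).mono Ioi_subset_Ici_self
  rw [(monotone_cdf ρ).continuousAt_iff_leftLim_eq_rightLim,
    (monotone_cdf ρ).continuousWithinAt_Ioi_iff_rightLim_eq.1 h1]
  have h2 := (cdf ρ).measure_singleton x
  rw [measure_cdf, measure_singleton] at h2
  have h3 := ENNReal.ofReal_eq_zero.1 h2.symm
  exact le_antisymm ((monotone_cdf ρ).leftLim_le le_rfl) (by linarith)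

theorem measure_cdf_le (ρ : Measure ℝ) [IsProbabilityMeasure ρ] [NullSingletonClass ρ] {t : ℝ}
    (ht0 : 0 ≤ t) (ht1 : t ≤ 1) : ρ {x | cdf ρ x ≤ t} = ENNReal.ofReal t := by
  have key : ∀ s, 0 < s → s < 1 → ∃ c, cdf ρ c = s := fun s hs0 hs1 ↦
    mem_range_of_exists_le_of_exists_ge (continuous_cdf_of_nullSingletonClass ρ)
      (((tendsto_cdf_atBot ρ).eventually_le_const hs0).exists)
      (((tendsto_cdf_atTop ρ).eventually_const_le hs1).exists)
  rcases ht1.eq_or_lt with rfl | ht1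
  · simp [cdf_le_one]
  apply le_antisymm
  · have : ∀ s ∈ Ioo t 1, ρ {x | cdf ρ x ≤ t} ≤ ENNReal.ofReal s := by
      rintro s ⟨hts, hs1⟩
      obtain ⟨d, rfl⟩ := key s (ht0.trans_lt hts) hs1
      rw [ofReal_cdf]
      refine measure_mono fun x (hx : cdf ρ x ≤ t) ↦ ?_
      exact ((monotone_cdf ρ).reflect_lt (hx.trans_lt hts)).le
    refine ge_of_tendsto (x := 𝓝[>] t) (f := ENNReal.ofReal) ?_ ?_
    · exact (ENNReal.continuous_ofReal.tendsto t).mono_left nhdsWithin_le_nhds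
    · filter_upwards [Ioo_mem_nhdsGT ht1] with s hs using this s hs
  · rcases ht0.eq_or_lt with rfl | ht0
    · simp
    obtain ⟨c, rfl⟩ := key t ht0 ht1
    rw [ofReal_cdf]
    exact measure_mono fun x hx ↦ monotone_cdf ρ hx

theorem map_cdf_eq (ρ : Measure ℝ) [IsProbabilityMeasure ρ] [NullSingletonClass ρ] :
    ρ.map (cdf ρ) = volume.restrict (Icc 0 1) := by
  have hm : Measurable (cdf ρ) := (monotone_cdf ρ).measurable
  have := Measure.isProbabilityMeasure_map (μ := ρ) hm.aemeasurable
  refine Measure.ext_of_Iic _ _ fun t ↦ ?_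
  rw [Measure.map_apply hm measurableSet_Iic, Measure.restrict_apply measurableSet_Iic]
  change ρ {x | cdf ρ x ≤ t} = _
  rcases lt_or_ge t 0 with ht0 | ht0
  · have h1 : {x | cdf ρ x ≤ t} = ∅ := by
      ext x; simpa using ht0.trans_le (cdf_nonneg ρ x)
    have h2 : Iic t ∩ Icc (0 : ℝ) 1 = ∅ := by
      ext x; simp only [mem_inter_iff, mem_Iic, mem_Icc, mem_empty_iff_false]; grind
    simp [h1, h2]
  rcases le_or_gt t 1 with ht1 | ht1
  · have h2 : Iic t ∩ Icc (0 : ℝ) 1 = Icc 0 t := by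
      ext x; simp only [mem_inter_iff, mem_Iic, mem_Icc]; grind
    rw [measure_cdf_le ρ ht0 ht1, h2]; simp
  · have h1 : {x | cdf ρ x ≤ t} = univ := by
      ext x; simpa using (cdf_le_one ρ x).trans ht1.le
    have h2 : Iic t ∩ Icc (0 : ℝ) 1 = Icc 0 1 := by
      ext x; simp only [mem_inter_iff, mem_Iic, mem_Icc]; grind
    simp [h1, h2]

theorem ae_le_iff_cdf_le (ρ : Measure ℝ) [IsProbabilityMeasure ρ] [NullSingletonClass ρ] (q : ℝ) :
    ∀ᵐ x ∂ρ, x ≤ q ↔ cdf ρ x ≤ cdf ρ q := by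
  have h : Iic q =ᵐ[ρ] {x | cdf ρ x ≤ cdf ρ q} := by
    refine ae_eq_of_subset_of_measure_ge (fun x hx ↦ monotone_cdf ρ hx) ?_
      measurableSet_Iic.nullMeasurableSet (measure_ne_top _ _)
    rw [measure_cdf_le ρ (cdf_nonneg ρ q) (cdf_le_one ρ q), ofReal_cdf]
  exact h.mem_iff

theorem measurable_cdf_kernel {β : Type*} [MeasurableSpace β] (κ : Kernel β ℝ)
    [IsMarkovKernel κ] : Measurable fun p : β × ℝ ↦ cdf (κ p.1) p.2 := by
  simp_rw [cdf_eq_real, Measure.real]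
  refine Measurable.ennreal_toReal ?_
  exact Kernel.measurable_kernel_prodMk_left (κ := κ.comap Prod.fst measurable_fst)
    (t := {p : (β × ℝ) × ℝ | p.2 ≤ p.1.2}) (measurableSet_le (by fun_prop) (by fun_prop))

theorem ae_nullSingletonClass_condDistrib {Ω β γ : Type*} [MeasurableSpace Ω]
    [MeasurableSpace β] [MeasurableSpace γ] (P : Measure Ω) [IsProbabilityMeasure P]
    {ξ : Ω → ℝ} {η : Ω → β} {ζ : Ω → γ} {h : ℝ × γ → ℝ} (hξ : Measurable ξ)
    (hη : Measurable η) (hζ : Measurable ζ) (hh : Measurable h)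
    (hind : IndepFun (fun ω ↦ h (ξ ω, ζ ω)) (fun ω ↦ (η ω, ζ ω)) P)
    [NullSingletonClass (P.map fun ω ↦ h (ξ ω, ζ ω))] :
    ∀ᵐ y ∂P.map η, NullSingletonClass (condDistrib ξ η P y) := by
  set κ := condDistrib ξ η P
  set V : Ω → ℝ := fun ω ↦ h (ξ ω, ζ ω) with hVdef
  have hV : Measurable V := by fun_prop
  have hηζ : Measurable fun ω ↦ (η ω, ζ ω) := by fun_prop
  have hprod := (indepFun_iff_map_prod_eq_prod_map_map hV.aemeasurable hηζ.aemeasurable).1 hind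
  have hm : Measurable fun p : ℝ × (β × γ) ↦ p.2.1 := by fun_prop
  have hS : MeasurableSet {p : (ℝ × (β × γ)) × ℝ | h (p.2, p.1.2.2) = p.1.1} :=
    measurableSet_eq_fun (by fun_prop) (by fun_prop)
  have hmeas := Kernel.measurable_kernel_prodMk_left (κ := κ.comap _ hm) hS
  have hnull : ∀ᵐ p ∂(P.map V).prod (P.map fun ω ↦ (η ω, ζ ω)),
      κ p.2.1 {x | h (x, p.2.2) = p.1} = 0 := by
    refine (lintegral_eq_zero_iff hmeas).1 ?_
    rw [lintegral_prod_symm _ hmeas.aemeasurable]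
    refine lintegral_eq_zero_of_ae_eq_zero (ae_of_all _ fun q ↦ ?_)
    have hT : MeasurableSet {p : ℝ × ℝ | h (p.2, q.2) = p.1} :=
      measurableSet_eq_fun (by fun_prop) (by fun_prop)
    have h1 := Measure.prod_apply (μ := P.map V) (ν := κ q.1) hT
    rw [Measure.prod_apply_symm hT] at h1
    refine h1.symm.trans ?_
    refine lintegral_eq_zero_of_ae_eq_zero (ae_of_all _ fun x ↦ ?_)
    have : (fun v : ℝ ↦ (v, x)) ⁻¹' {p : ℝ × ℝ | h (p.2, q.2) = p.1} = {h (x, q.2)} := by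
      ext v; simp [eq_comm]
    simp [this]
  rw [← hprod] at hnull
  have hP : ∀ᵐ ω ∂P, κ (η ω) {ξ ω} = 0 := by
    filter_upwards [ae_of_ae_map (by fun_prop) hnull] with ω hω
    exact measure_mono_null (by simp [hVdef]) hω
  have hmeas2 := Kernel.measurable_kernel_prodMk_left (κ := κ.comap Prod.fst measurable_fst)
    (t := {p : (β × ℝ) × ℝ | p.2 = p.1.2}) (measurableSet_eq_fun (by fun_prop) (by fun_prop))
  have hmap : ∀ᵐ p ∂P.map fun ω ↦ (η ω, ξ ω), κ p.1 {x | x = p.2} = 0 :=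
    (ae_map_iff (by fun_prop) (hmeas2 (measurableSet_singleton 0))).2 hP
  rw [← compProd_map_condDistrib hξ.aemeasurable] at hmap
  filter_upwards [Measure.ae_ae_of_ae_compProd hmap] with y hy
  refine ⟨fun x ↦ ?_⟩
  by_contra hx
  exact hx (measure_mono_null (s := {x}) (by simpa using hx) hy)

theorem map_prodMk_cdf_condDistrib {Ω β : Type*} [MeasurableSpace Ω]
    [MeasurableSpace β] (P : Measure Ω) [IsProbabilityMeasure P]
    {ξ : Ω → ℝ} {η : Ω → β} (hξ : Measurable ξ) (hη : Measurable η)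
    (hna : ∀ᵐ y ∂P.map η, NullSingletonClass (condDistrib ξ η P y)) :
    P.map (fun ω ↦ (η ω, cdf (condDistrib ξ η P (η ω)) (ξ ω))) =
      (P.map η).prod (volume.restrict (Icc 0 1)) := by
  set κ := condDistrib ξ η P
  have : IsProbabilityMeasure (P.map η) := Measure.isProbabilityMeasure_map hη.aemeasurable
  have hF := measurable_cdf_kernel κ
  have hG : Measurable fun p : β × ℝ ↦ (p.1, cdf (κ p.1) p.2) := measurable_fst.prodMk hF
  have hmap : P.map (fun ω ↦ (η ω, cdf (κ (η ω)) (ξ ω))) =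
      (P.map η ⊗ₘ κ).map fun p ↦ (p.1, cdf (κ p.1) p.2) := by
    rw [compProd_map_condDistrib hξ.aemeasurable, Measure.map_map hG (by fun_prop)]
    rfl
  rw [hmap]
  symm
  refine Measure.prod_eq fun s t hs ht ↦ ?_
  rw [Measure.map_apply hG (hs.prod ht), Measure.compProd_apply (hG (hs.prod ht)),
    mul_comm, ← lintegral_indicator_const hs]
  refine lintegral_congr_ae ?_
  filter_upwards [hna] with y hy
  by_cases hys : y ∈ s
  · rw [indicator_of_mem hys, ← map_cdf_eq (κ y),
      Measure.map_apply (monotone_cdf _).measurable ht]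
    congr 1
    ext x; simp [hys]
  · rw [indicator_of_notMem hys]
    have : Prod.mk y ⁻¹' ((fun p : β × ℝ ↦ (p.1, cdf (κ p.1) p.2)) ⁻¹' s ×ˢ t) = ∅ := by
      ext x; simp [hys]
    rw [this, measure_empty]

theorem ae_le_iff_condCDF_le {Ω β : Type*} [MeasurableSpace Ω]
    [MeasurableSpace β] (P : Measure Ω) [IsProbabilityMeasure P]
    {ξ : Ω → ℝ} {η : Ω → β} (hξ : Measurable ξ) (hη : Measurable η)
    (hna : ∀ᵐ y ∂P.map η, NullSingletonClass (condDistrib ξ η P y)) (q : ℝ) :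
    ∀ᵐ ω ∂P, ξ ω ≤ q ↔
      cdf (condDistrib ξ η P (η ω)) (ξ ω) ≤ cdf (condDistrib ξ η P (η ω)) q := by
  set κ := condDistrib ξ η P
  have hF := measurable_cdf_kernel κ
  have hFq : Measurable fun p : β × ℝ ↦ cdf (κ p.1) q :=
    hF.comp (measurable_fst.prodMk measurable_const)
  have hS : MeasurableSet {p : β × ℝ | p.2 ≤ q ↔ cdf (κ p.1) p.2 ≤ cdf (κ p.1) q} :=
    (measurableSet_le measurable_snd measurable_const).iff (measurableSet_le hF hFq)
  have h : ∀ᵐ p ∂P.map η ⊗ₘ κ, p.2 ≤ q ↔ cdf (κ p.1) p.2 ≤ cdf (κ p.1) q := by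
    rw [Measure.ae_compProd_iff hS]
    filter_upwards [hna] with y hy using ae_le_iff_cdf_le (κ y) q
  rw [compProd_map_condDistrib hξ.aemeasurable] at h
  exact ae_of_ae_map (by fun_prop) h

theorem exists_comap_real_eq {Ω : Type*} [S : MeasurableSpace Ω]
    [MeasurableSpace.CountablyGenerated Ω] :
    ∃ ξ : Ω → ℝ, S = MeasurableSpace.comap ξ inferInstance := by
  refine ⟨embeddingReal (ℕ → Bool) ∘ MeasurableSpace.mapNatBool Ω, ?_⟩
  rw [← MeasurableSpace.comap_comp, (measurableEmbedding_embeddingReal _).comap_eq]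
  refine le_antisymm ?_ (MeasurableSpace.measurable_mapNatBool Ω).comap_le
  conv_lhs => rw [← MeasurableSpace.generateFrom_natGeneratingSequence Ω]
  refine MeasurableSpace.generateFrom_le ?_
  rintro _ ⟨n, rfl⟩
  refine ⟨(fun x ↦ x n) ⁻¹' {true}, measurable_pi_apply n (measurableSet_singleton true), ?_⟩
  ext ω
  simp [MeasurableSpace.mapNatBool]

theorem exists_countablyGenerated_le {Ω : Type*} {G m₀ : MeasurableSpace Ω}
    (μ : Measure[m₀] Ω) [IsFiniteMeasure μ] [@MeasurableSpace.CountablyGenerated Ω m₀]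
    (hG : G ≤ m₀) :
    ∃ S ≤ G, @MeasurableSpace.CountablyGenerated Ω S ∧
      ∀ A, MeasurableSet[G] A → ∃ B, MeasurableSet[S] B ∧ A =ᵐ[μ] B := by
  let f : {A : Set Ω // MeasurableSet[G] A} → Lp ℝ 1 μ := fun A ↦
    indicatorConstLp 1 (hG _ A.2) (measure_ne_top μ _) 1
  let : TopologicalSpace {A : Set Ω // MeasurableSet[G] A} := .induced f inferInstance
  have hf : Continuous f := continuous_induced_dom
  have : Fact ((1 : ENNReal) ≠ ⊤) := ⟨ENNReal.one_ne_top⟩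
  have : SecondCountableTopology {A : Set Ω // MeasurableSet[G] A} :=
    TopologicalSpace.secondCountableTopology_induced _ _ f
  obtain ⟨D, hDc, hD⟩ := TopologicalSpace.exists_countable_dense {A : Set Ω // MeasurableSet[G] A}
  have hSG : MeasurableSpace.generateFrom (Subtype.val '' D) ≤ G := by
    refine MeasurableSpace.generateFrom_le ?_
    rintro _ ⟨A, -, rfl⟩
    exact A.2
  refine ⟨.generateFrom (Subtype.val '' D), hSG,
    @MeasurableSpace.CountablyGenerated.mk _ (_) ⟨_, hDc.image _, rfl⟩, fun A hA ↦ ?_⟩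
  have hcl : f ⟨A, hA⟩ ∈ closure (f '' D) :=
    image_closure_subset_closure_image hf ⟨_, hD _, rfl⟩
  have hmem := closure_minimal (t := {g : Lp ℝ 1 μ |
      AEStronglyMeasurable[.generateFrom (Subtype.val '' D)] g μ}) ?_
      (isClosed_aestronglyMeasurable (hSG.trans hG)) hcl
  · obtain ⟨g, hg, hfg⟩ := hmem
    refine ⟨g ⁻¹' {1}, @StronglyMeasurable.measurable _ _ (_) _ _ _ _ _ hg _
      (measurableSet_singleton 1), ?_⟩
    filter_upwards [hfg, indicatorConstLp_coeFn (p := 1) (hs := hG _ hA)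
      (hμs := measure_ne_top μ A) (c := (1 : ℝ))] with ω h1 h2
    rw [h2] at h1
    by_cases hω : ω ∈ A
    · simp only [hω, indicator_of_mem] at h1
      exact propext ⟨fun _ ↦ h1.symm, fun _ ↦ hω⟩
    · simp only [hω, not_false_eq_true, indicator_of_notMem] at h1
      refine propext ⟨fun h ↦ (hω h).elim, fun h ↦ ?_⟩
      have h' : g ω = 1 := h
      rw [h'] at h1
      exact (zero_ne_one h1).elim
  · rintro _ ⟨B, hB, rfl⟩
    refine ⟨B.1.indicator fun _ ↦ 1, ?_, indicatorConstLp_coeFn⟩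
    exact stronglyMeasurable_const.indicator
      (MeasurableSpace.measurableSet_generateFrom ⟨B, hB, rfl⟩)

theorem measurableSet_of_ae_eq {Ω : Type*} {X m : MeasurableSpace Ω} {P : Measure Ω}
    (hXm : X ≤ m) (hX : zeroLambda m P ≤ X) {A B : Set Ω} (hA : MeasurableSet[m] A)
    (hB : MeasurableSet[X] B) (hAB : A =ᵐ[P] B) : MeasurableSet[X] A := by
  have hnull : ∀ N, MeasurableSet[m] N → P N = 0 → MeasurableSet[X] N := fun N hN hN0 ↦
    hX _ (MeasurableSpace.measurableSet_generateFrom ⟨hN, Or.inl hN0⟩)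
  have h1 := hnull (A \ B) (hA.diff (hXm _ hB)) (ae_le_set.1 hAB.le)
  have h2 := hnull (B \ A) ((hXm _ hB).diff hA) (ae_le_set.1 hAB.symm.le)
  have : A = (B \ (B \ A)) ∪ (A \ B) := by ext; simp only [mem_union, Set.mem_sdiff]; tauto
  rw [this]
  exact (hB.diff h2).union h1

theorem exists_measurableSet_ae_eq_of_sup_zeroLambda {Ω : Type*} {S m : MeasurableSpace Ω}
    {P : Measure Ω} [IsProbabilityMeasure P] {A : Set Ω}
    (hA : MeasurableSet[S ⊔ zeroLambda m P] A) : ∃ B, MeasurableSet[S] B ∧ A =ᵐ[P] B := by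
  have h : S ⊔ zeroLambda m P ≤ eventuallyMeasurableSpace S (ae P) := by
    refine sup_le (@le_eventuallyMeasurableSpace _ S _ _) (MeasurableSpace.generateFrom_le ?_)
    rintro N ⟨hN, h0 | h1⟩
    · exact ⟨∅, @MeasurableSet.empty _ S, ae_eq_empty.2 h0⟩
    · exact ⟨univ, @MeasurableSet.univ _ S, ae_eq_univ.2 ((prob_compl_eq_zero_iff hN).2 h1)⟩
  exact h _ hA

theorem exists_eq_sigmaBar_of_le {Ω : Type*} {X m : MeasurableSpace Ω} {P : Measure Ω}
    [IsProbabilityMeasure P] (hXm : X ≤ m) (hX : zeroLambda m P ≤ X) {ξ₀ : Ω → ℝ}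
    (hξ₀ : Measurable[m] ξ₀) (hle : X ≤ sigmaBar m P ξ₀) :
    ∃ ξ : Ω → ℝ, Measurable[X] ξ ∧ X = sigmaBar m P ξ := by
  have hm₀ : MeasurableSpace.comap ξ₀ inferInstance ≤ m := hξ₀.comap_le
  have : @MeasurableSpace.CountablyGenerated Ω (MeasurableSpace.comap ξ₀ inferInstance) :=
    MeasurableSpace.CountablyGenerated.comap ξ₀
  obtain ⟨S, hSG, hS, hdense⟩ := exists_countablyGenerated_le (P.trim hm₀)
    (G := X ⊓ MeasurableSpace.comap ξ₀ inferInstance) inf_le_right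
  obtain ⟨ξ, rfl⟩ := exists_comap_real_eq (S := S)
  have hξX : MeasurableSpace.comap ξ inferInstance ≤ X := hSG.trans inf_le_left
  refine ⟨ξ, measurable_iff_comap_le.2 hξX, le_antisymm (fun A hA ↦ ?_) (sup_le hξX hX)⟩
  obtain ⟨B, hB, hAB⟩ := exists_measurableSet_ae_eq_of_sup_zeroLambda (hle _ hA)
  have hBX : MeasurableSet[X] B := measurableSet_of_ae_eq hXm hX (hm₀ _ hB) hA hAB.symm
  obtain ⟨C, hC, hBC⟩ := hdense B (MeasurableSpace.measurableSet_inf.2 ⟨hBX, hB⟩)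
  exact measurableSet_of_ae_eq (sup_le (hξX.trans hXm) (hX.trans hXm)) le_sup_right (hXm _ hA)
    (le_sup_left (a := MeasurableSpace.comap ξ inferInstance) _ hC)
    (hAB.trans (ae_eq_of_ae_eq_trim hBC))

theorem exists_uniform_indep {Ω β γ : Type*} [MeasurableSpace Ω] [mβ : MeasurableSpace β]
    [mγ : MeasurableSpace γ] (P : Measure Ω) [IsProbabilityMeasure P]
    {ξ : Ω → ℝ} {η : Ω → β} {ζ : Ω → γ} {V : Ω → ℝ} (hξ : Measurable ξ)
    (hη : Measurable η) (hζ : Measurable ζ)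
    (hV : Measurable[MeasurableSpace.comap ξ inferInstance ⊔ mγ.comap ζ] V)
    (hind : Indep (MeasurableSpace.comap V inferInstance) (mβ.comap η ⊔ mγ.comap ζ) P)
    [NullSingletonClass (P.map V)] :
    ∃ U : Ω → ℝ, Measurable[mβ.comap η ⊔ MeasurableSpace.comap ξ inferInstance] U ∧
      (∀ ω, U ω ∈ Icc (0 : ℝ) 1) ∧ P.map U = volume.restrict (Icc (0 : ℝ) 1) ∧
      Indep (MeasurableSpace.comap U inferInstance) (mβ.comap η) P ∧
      ∀ q, ∃ B, MeasurableSet[mβ.comap η ⊔ MeasurableSpace.comap U inferInstance] B ∧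
        ξ ⁻¹' Iic q =ᵐ[P] B := by
  rw [← MeasurableSpace.comap_prodMk] at hV
  rw [← MeasurableSpace.comap_prodMk, ← IndepFun_iff_Indep] at hind
  obtain ⟨h, hh, rfl⟩ := hV.exists_eq_measurable_comp
  have : NullSingletonClass (P.map fun ω ↦ h (ξ ω, ζ ω)) := ‹_›
  have hna := ae_nullSingletonClass_condDistrib P hξ hη hζ hh hind
  have hF := measurable_cdf_kernel (condDistrib ξ η P)
  have hηξ : Measurable fun ω ↦ (η ω, ξ ω) := hη.prodMk hξ
  set U : Ω → ℝ := fun ω ↦ cdf (condDistrib ξ η P (η ω)) (ξ ω) with hUdef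
  have hU : Measurable U := hF.comp hηξ
  have hlaw := map_prodMk_cdf_condDistrib P hξ hη hna
  have : IsProbabilityMeasure (P.map η) := Measure.isProbabilityMeasure_map hη.aemeasurable
  have hUlaw : P.map U = volume.restrict (Icc (0 : ℝ) 1) := by
    have hsnd := congrArg Measure.snd hlaw
    rwa [Measure.snd_map_prodMk hη, Measure.snd_prod] at hsnd
  refine ⟨U, ?_, fun ω ↦ ⟨cdf_nonneg _ _, cdf_le_one _ _⟩, hUlaw, ?_, fun q ↦ ?_⟩
  · rw [← MeasurableSpace.comap_prodMk]
    exact hF.comp (comap_measurable fun ω ↦ (η ω, ξ ω))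
  · refine (IndepFun_iff_Indep _ _ _).1 (IndepFun.symm ((indepFun_iff_map_prod_eq_prod_map_map
      hη.aemeasurable hU.aemeasurable).2 ?_))
    rw [hlaw, hUlaw]
  · have hFq : Measurable fun p : β × ℝ ↦ cdf (condDistrib ξ η P p.1) q :=
      hF.comp (measurable_fst.prodMk measurable_const)
    refine ⟨{ω | U ω ≤ cdf (condDistrib ξ η P (η ω)) q}, ?_, ?_⟩
    · rw [← MeasurableSpace.comap_prodMk]
      exact ⟨{p | p.2 ≤ cdf (condDistrib ξ η P p.1) q}, measurableSet_le measurable_snd hFq, rfl⟩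
    · filter_upwards [ae_le_iff_condCDF_le P hξ hη hna q] with ω hω
      exact propext hω

/-- If `X ∨ Z` is conditionally non-atomic given `Y ∨ Z`, then `X` is conditionally
non-atomic given `Y`. -/
theorem stmt11 {Ω : Type*} {m : MeasurableSpace Ω} (P : Measure Ω) [IsProbabilityMeasure P]
    (X Y Z : MeasurableSpace Ω) (hXm : X ≤ m) (hYm : Y ≤ m) (hZm : Z ≤ m)
    (hXc : zeroLambda m P ≤ X) (hYc : zeroLambda m P ≤ Y) (hZc : zeroLambda m P ≤ Z)
    (hYX : Y ≤ X)
    (hsep : ∃ ξ : Ω → ℝ, Measurable[m] ξ ∧ X ⊔ Z = sigmaBar m P ξ)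
    (hCNA : CondNonAtomic m P (X ⊔ Z) (Y ⊔ Z)) :
    CondNonAtomic m P X Y := by
  obtain ⟨ξ₀, hξ₀, hξ₀XZ⟩ := hsep
  obtain ⟨V, hVmeas, -, hVlaw, hVind, -⟩ := hCNA
  obtain ⟨ξ, hξX, hXξ⟩ := exists_eq_sigmaBar_of_le hXm hXc hξ₀ (le_sup_left.trans hξ₀XZ.le)
  have hξ : Measurable[m] ξ := hξX.mono hXm le_rfl
  have hVξ : Measurable[MeasurableSpace.comap ξ inferInstance ⊔ Z] V := by
    refine hVmeas.mono (sup_le ?_ le_sup_right) le_rfl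
    rw [hXξ]
    exact sup_le le_sup_left (hZc.trans le_sup_right)
  have : NullSingletonClass (@Measure.map Ω ℝ m _ V P) := by
    rw [hVlaw]; infer_instance
  have hid (W : MeasurableSpace Ω) : W.comap id = W := @MeasurableSpace.comap_id _ W
  have hcore := @exists_uniform_indep Ω Ω Ω m Y Z P _ ξ id id V hξ hYm hZm
  rw [hid, hid] at hcore
  obtain ⟨U, hU, hU01, hUlaw, hUind, hUξ⟩ := hcore hVξ hVind
  have hUX : Measurable[X] U := hU.mono (sup_le hYX hξX.comap_le) le_rfl
  have hle : Y ⊔ sigmaBar m P U ≤ X := sup_le hYX (sup_le hUX.comap_le hXc)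
  refine ⟨U, hUX, hU01, hUlaw, hUind, le_antisymm hle ?_⟩
  have hcomplete : zeroLambda m P ≤ Y ⊔ sigmaBar m P U := hYc.trans le_sup_left
  rw [hXξ]
  refine sup_le (Measurable.comap_le ?_) hcomplete
  refine measurable_of_Iic (mδ := Y ⊔ sigmaBar m P U) fun q ↦ ?_
  obtain ⟨B, hB, hqB⟩ := hUξ q
  exact measurableSet_of_ae_eq (hle.trans hXm) hcomplete (hξ measurableSet_Iic)
    (sup_le_sup_left le_sup_left Y _ hB) hqB
end

section
/- Let X, Y, Z be complete sub-σ-fields of a probability space (Ω, M, P) with X and Y independent and Z ⊆ X ∨ Y. The following are equivalent: (i) Z = (X ∧ Z) ∨ (Y ∧ Z); (ii) X and Y are conditionally independent given Z, and for every B ∈ Y the conditional probability P[B | Z] has a Y-measurable version, and for every A ∈ X the conditional probability P[A | Z] has an X-measurable version. -/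
open MeasureTheory ProbabilityTheory

/-- The conditional probability `P[A | W]` of an event `A` given a σ-field `W`,
as a random variable (conditional expectation of the indicator). -/
noncomputable def condProb {Ω : Type*} {m : MeasurableSpace Ω} (P : Measure Ω)
    (W : MeasurableSpace Ω) (A : Set Ω) : Ω → ℝ :=
  P[A.indicator (fun _ => (1 : ℝ)) | W]

/-- Two σ-fields `A`, `B` are conditionally independent given `W` if
`P[A₀ ∩ B₀ | W] = P[A₀ | W] · P[B₀ | W]` a.s. for all `A₀ ∈ A`, `B₀ ∈ B`. -/
def CondIndepPair {Ω : Type*} {m : MeasurableSpace Ω} (P : Measure Ω)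
    (W A B : MeasurableSpace Ω) : Prop :=
  ∀ A₀ B₀ : Set Ω, MeasurableSet[A] A₀ → MeasurableSet[B] B₀ →
    condProb P W (A₀ ∩ B₀) =ᵐ[P] fun ω => condProb P W A₀ ω * condProb P W B₀ ω

theorem measurableSet_of_ae_eq_of_zeroLambda_le {Ω : Type*} {m : MeasurableSpace Ω}
    {P : Measure Ω} {W : MeasurableSpace Ω} (hW : zeroLambda m P ≤ W) (hWm : W ≤ m)
    {A B : Set Ω} (hA : MeasurableSet[m] A) (hB : MeasurableSet[W] B) (hAB : A =ᵐ[P] B) :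
    MeasurableSet[W] A := by
  have hnull : MeasurableSet[W] (symmDiff B A) :=
    hW _ (MeasurableSpace.measurableSet_generateFrom
      ⟨(hWm B hB).symmDiff hA, Or.inl (measure_symmDiff_eq_zero_iff.mpr hAB.symm)⟩)
  rw [← symmDiff_symmDiff_cancel_left B A]
  exact MeasurableSet.symmDiff hB hnull

theorem measurable_of_ae_eq_of_zeroLambda_le {Ω β : Type*} [MeasurableSpace β]
    {m : MeasurableSpace Ω} {P : Measure Ω} {W : MeasurableSpace Ω} (hW : zeroLambda m P ≤ W)
    (hWm : W ≤ m) {f g : Ω → β} (hf : Measurable[m] f) (hg : Measurable[W] g)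
    (hfg : f =ᵐ[P] g) : Measurable[W] f := fun s hs =>
  measurableSet_of_ae_eq_of_zeroLambda_le hW hWm (hf hs) (hg hs) (hfg.preimage s)

/-- Intersections of an event of `X` with an event of `Y` generate `X ⊔ Y`. -/
theorem sup_eq_generateFrom_image2_inter {Ω : Type*} (X Y : MeasurableSpace Ω) :
    X ⊔ Y = MeasurableSpace.generateFrom
      (Set.image2 (· ∩ ·) {A | MeasurableSet[X] A} {B | MeasurableSet[Y] B}) := by
  refine le_antisymm (sup_le (fun A hA => ?_) (fun B hB => ?_))
    (MeasurableSpace.generateFrom_le ?_)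
  · exact MeasurableSpace.measurableSet_generateFrom
      ⟨A, hA, Set.univ, MeasurableSet.univ, Set.inter_univ A⟩
  · exact MeasurableSpace.measurableSet_generateFrom
      ⟨Set.univ, MeasurableSet.univ, B, hB, Set.univ_inter B⟩
  · rintro _ ⟨A, hA, B, hB, rfl⟩
    exact MeasurableSet.inter ((le_sup_left : X ≤ X ⊔ Y) A hA)
      ((le_sup_right : Y ≤ X ⊔ Y) B hB)

theorem isPiSystem_image2_inter {Ω : Type*} (X Y : MeasurableSpace Ω) :
    IsPiSystem (Set.image2 (· ∩ ·) {A | MeasurableSet[X] A} {B | MeasurableSet[Y] B}) := by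
  rintro _ ⟨A, hA, B, hB, rfl⟩ _ ⟨A', hA', B', hB', rfl⟩ -
  exact ⟨A ∩ A', MeasurableSet.inter hA hA', B ∩ B', MeasurableSet.inter hB hB',
    Set.inter_inter_inter_comm A A' B B'⟩

theorem setIntegral_eq_of_forall_inter {Ω : Type*} {m : MeasurableSpace Ω} {P : Measure Ω}
    {X Y : MeasurableSpace Ω} (hXm : X ≤ m) (hYm : Y ≤ m) {f g : Ω → ℝ}
    (hf : Integrable f P) (hg : Integrable g P)
    (h : ∀ A B, MeasurableSet[X] A → MeasurableSet[Y] B →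
      ∫ ω in A ∩ B, f ω ∂P = ∫ ω in A ∩ B, g ω ∂P)
    {C : Set Ω} (hC : MeasurableSet[X ⊔ Y] C) :
    ∫ ω in C, f ω ∂P = ∫ ω in C, g ω ∂P := by
  have hle : X ⊔ Y ≤ m := sup_le hXm hYm
  have huniv : ∫ ω, f ω ∂P = ∫ ω, g ω ∂P := by
    simpa using h Set.univ Set.univ MeasurableSet.univ MeasurableSet.univ
  refine MeasurableSpace.induction_on_inter
    (C := fun C _ => ∫ ω in C, f ω ∂P = ∫ ω in C, g ω ∂P)
    (sup_eq_generateFrom_image2_inter X Y) (isPiSystem_image2_inter X Y)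
    (by simp) ?_ ?_ ?_ C hC
  · rintro _ ⟨A, hA, B, hB, rfl⟩
    exact h A B hA hB
  · intro t ht hteq
    have hft := integral_add_compl (hle t ht) hf
    have hgt := integral_add_compl (hle t ht) hg
    linarith
  · intro s hdisj hs heq
    rw [integral_iUnion (fun i => hle _ (hs i)) hdisj hf.integrableOn,
      integral_iUnion (fun i => hle _ (hs i)) hdisj hg.integrableOn]
    simp only [heq]

theorem integrable_indicator_one {Ω : Type*} {m : MeasurableSpace Ω} (P : Measure Ω)
    [IsFiniteMeasure P] {A : Set Ω} (hA : MeasurableSet[m] A) :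
    Integrable (A.indicator fun _ => (1 : ℝ)) P :=
  (integrable_const 1).indicator hA

theorem ae_norm_condProb_le_one {Ω : Type*} {m : MeasurableSpace Ω} (P : Measure Ω)
    (W : MeasurableSpace Ω) (A : Set Ω) : ∀ᵐ ω ∂P, ‖condProb P W A ω‖ ≤ 1 := by
  refine ae_bdd_abs_condExp_of_ae_bdd_abs (R := (1 : ℝ)) (Filter.Eventually.of_forall fun ω => ?_)
  by_cases h : ω ∈ A <;> simp [h]

theorem integrable_condProb_mul_condProb {Ω : Type*} {m : MeasurableSpace Ω} (P : Measure Ω)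
    (V W : MeasurableSpace Ω) (A B : Set Ω) :
    Integrable (condProb P V A * condProb P W B) P :=
  Integrable.bdd_mul (c := 1) integrable_condExp
    integrable_condExp.aestronglyMeasurable (ae_norm_condProb_le_one P V A)

theorem setIntegral_condProb_eq_integral_mul {Ω : Type*} {m : MeasurableSpace Ω} (P : Measure Ω)
    [IsFiniteMeasure P] {W : MeasurableSpace Ω} (hWm : W ≤ m) {C : Set Ω}
    (hC : MeasurableSet[m] C) (D : Set Ω) :
    ∫ ω in C, condProb P W D ω ∂P = ∫ ω, (condProb P W C * condProb P W D) ω ∂P := by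
  have hmul : (C.indicator fun _ => (1 : ℝ)) * condProb P W D = C.indicator (condProb P W D) := by
    ext ω
    by_cases h : ω ∈ C <;> simp [h]
  have hpull : P[(C.indicator fun _ => (1 : ℝ)) * condProb P W D | W]
      =ᵐ[P] condProb P W C * condProb P W D :=
    condExp_mul_of_stronglyMeasurable_right stronglyMeasurable_condExp
      (hmul ▸ integrable_condExp.indicator hC) (integrable_indicator_one P hC)
  rw [← integral_congr_ae hpull, integral_condExp hWm, hmul, integral_indicator hC]

/-- The conditional expectation onto `W` is self-adjoint. -/
theorem setIntegral_condProb_comm {Ω : Type*} {m : MeasurableSpace Ω} (P : Measure Ω)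
    [IsFiniteMeasure P] {W : MeasurableSpace Ω} (hWm : W ≤ m) {C D : Set Ω}
    (hC : MeasurableSet[m] C) (hD : MeasurableSet[m] D) :
    ∫ ω in C, condProb P W D ω ∂P = ∫ ω in D, condProb P W C ω ∂P := by
  rw [setIntegral_condProb_eq_integral_mul P hWm hC, setIntegral_condProb_eq_integral_mul P hWm hD,
    mul_comm]

theorem condProb_eq_indicator_of_measurableSet {Ω : Type*} {m : MeasurableSpace Ω}
    (P : Measure Ω) [IsFiniteMeasure P] {W : MeasurableSpace Ω} (hWm : W ≤ m) {A : Set Ω}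
    (hA : MeasurableSet[W] A) : condProb P W A = A.indicator fun _ => 1 :=
  condExp_of_stronglyMeasurable hWm (stronglyMeasurable_const.indicator hA)
    (integrable_indicator_one P (hWm A hA))

theorem Indep.setIntegral_inter_mul {Ω : Type*} {m : MeasurableSpace Ω} {P : Measure Ω}
    {X Y : MeasurableSpace Ω} (hXm : X ≤ m) (hYm : Y ≤ m) (hIndep : Indep X Y P)
    {f g : Ω → ℝ} (hf : Measurable[X] f) (hg : Measurable[Y] g) {A B : Set Ω}
    (hA : MeasurableSet[X] A) (hB : MeasurableSet[Y] B) :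
    ∫ ω in A ∩ B, (f * g) ω ∂P = (∫ ω in A, f ω ∂P) * ∫ ω in B, g ω ∂P := by
  have hfA : Measurable[X] (A.indicator f) := hf.indicator hA
  have hgB : Measurable[Y] (B.indicator g) := hg.indicator hB
  have hind : IndepFun (A.indicator f) (B.indicator g) P := by
    rw [IndepFun_iff_Indep]
    exact indep_of_indep_of_le_left (indep_of_indep_of_le_right hIndep hgB.comap_le) hfA.comap_le
  have hmul := hind.integral_mul_eq_mul_integral
    (hfA.mono hXm le_rfl).aestronglyMeasurable (hgB.mono hYm le_rfl).aestronglyMeasurable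
  rw [integral_indicator (hXm A hA), integral_indicator (hYm B hB)] at hmul
  rw [← hmul, ← integral_indicator ((hXm A hA).inter (hYm B hB))]
  exact integral_congr_ae (Filter.Eventually.of_forall fun ω => Set.inter_indicator_mul f g ω)

/-- For independent `X` and `Y`, conditioning on the join of sub-σ-fields of `X` and `Y`
factorizes. -/
theorem condProb_inter_sup_ae_eq_mul {Ω : Type*} {m : MeasurableSpace Ω} (P : Measure Ω)
    [IsFiniteMeasure P] {X Y X' Y' : MeasurableSpace Ω} (hXm : X ≤ m) (hYm : Y ≤ m)
    (hX' : X' ≤ X) (hY' : Y' ≤ Y) (hIndep : Indep X Y P) {A B : Set Ω}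
    (hA : MeasurableSet[X] A) (hB : MeasurableSet[Y] B) :
    condProb P (X' ⊔ Y') (A ∩ B) =ᵐ[P] condProb P X' A * condProb P Y' B := by
  have hX'm := hX'.trans hXm
  have hY'm := hY'.trans hYm
  have hAm := hXm A hA
  have hBm := hYm B hB
  have hint := integrable_condProb_mul_condProb P X' Y' A B
  refine (ae_eq_condExp_of_forall_setIntegral_eq (sup_le hX'm hY'm)
    (integrable_indicator_one P (hAm.inter hBm)) (fun _ _ _ => hint.integrableOn) ?_ ?_).symm
  · intro C hC _
    refine setIntegral_eq_of_forall_inter hX'm hY'm hint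
      (integrable_indicator_one P (hAm.inter hBm)) (fun S T hS hT => ?_) hC
    rw [Indep.setIntegral_inter_mul (f := condProb P X' A) (g := condProb P Y' B) hXm hYm hIndep
      (stronglyMeasurable_condExp.measurable.mono hX' le_rfl)
      (stronglyMeasurable_condExp.measurable.mono hY' le_rfl) (hX' S hS) (hY' T hT)]
    unfold condProb
    rw [setIntegral_condExp hX'm (integrable_indicator_one P hAm) hS,
      setIntegral_condExp hY'm (integrable_indicator_one P hBm) hT,
      ← Indep.setIntegral_inter_mul hXm hYm hIndep (measurable_const.indicator hA)
        (measurable_const.indicator hB) (hX' S hS) (hY' T hT)]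
    refine integral_congr_ae (Filter.Eventually.of_forall fun ω => ?_)
    by_cases hωA : ω ∈ A <;> by_cases hωB : ω ∈ B <;> simp [hωA, hωB]
  · exact ((stronglyMeasurable_condExp.mono le_sup_left).mul
      (stronglyMeasurable_condExp.mono le_sup_right)).aestronglyMeasurable

theorem condProb_sup_ae_eq_left {Ω : Type*} {m : MeasurableSpace Ω} (P : Measure Ω)
    [IsProbabilityMeasure P] {X Y X' Y' : MeasurableSpace Ω} (hXm : X ≤ m) (hYm : Y ≤ m)
    (hX' : X' ≤ X) (hY' : Y' ≤ Y) (hIndep : Indep X Y P) {A : Set Ω} (hA : MeasurableSet[X] A) :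
    condProb P (X' ⊔ Y') A =ᵐ[P] condProb P X' A := by
  have h := condProb_inter_sup_ae_eq_mul P hXm hYm hX' hY' hIndep hA MeasurableSet.univ
  rw [condProb_eq_indicator_of_measurableSet P (hY'.trans hYm) MeasurableSet.univ] at h
  simpa [← Pi.one_def] using h

theorem condProb_sup_ae_eq_right {Ω : Type*} {m : MeasurableSpace Ω} (P : Measure Ω)
    [IsProbabilityMeasure P] {X Y X' Y' : MeasurableSpace Ω} (hXm : X ≤ m) (hYm : Y ≤ m)
    (hX' : X' ≤ X) (hY' : Y' ≤ Y) (hIndep : Indep X Y P) {B : Set Ω} (hB : MeasurableSet[Y] B) :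
    condProb P (X' ⊔ Y') B =ᵐ[P] condProb P Y' B := by
  rw [sup_comm]
  exact condProb_sup_ae_eq_left P hYm hXm hY' hX' hIndep.symm hB

theorem measurable_inf_of_condProb_ae_eq {Ω : Type*} {m : MeasurableSpace Ω} {P : Measure Ω}
    {X Z : MeasurableSpace Ω} (hXm : X ≤ m) (hZm : Z ≤ m) (hZc : zeroLambda m P ≤ Z)
    {A : Set Ω} {g : Ω → ℝ} (hg : Measurable[X] g) (hAg : condProb P Z A =ᵐ[P] g) :
    Measurable[X ⊓ Z] g := fun _ hs => MeasurableSpace.measurableSet_inf.mpr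
  ⟨hg hs, measurable_of_ae_eq_of_zeroLambda_le hZc hZm (hg.mono hXm le_rfl)
    stronglyMeasurable_condExp.measurable hAg.symm hs⟩

theorem condProb_ae_eq_of_le_of_ae_eq_measurable {Ω : Type*} {m : MeasurableSpace Ω}
    {P : Measure Ω} [IsFiniteMeasure P] {W Z : MeasurableSpace Ω} (hWZ : W ≤ Z) (hZm : Z ≤ m)
    {C : Set Ω} {g : Ω → ℝ} (hg : Measurable[W] g) (hCg : condProb P Z C =ᵐ[P] g) :
    condProb P W C =ᵐ[P] condProb P Z C := by
  have hgint : Integrable g P := integrable_condExp.congr hCg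
  calc condProb P W C =ᵐ[P] P[condProb P Z C | W] := (condExp_condExp_of_le hWZ hZm).symm
    _ =ᵐ[P] P[g | W] := condExp_congr_ae hCg
    _ = g := condExp_of_stronglyMeasurable (hWZ.trans hZm) hg.stronglyMeasurable hgint
    _ =ᵐ[P] condProb P Z C := hCg.symm

/-- If conditioning on `W` and on `Z ⊇ W` agree for the events `A ∩ B` generating `X ⊔ Y ⊇ Z`,
then `Z ≤ W`, provided that `W` is complete. -/
theorem le_of_condProb_inter_ae_eq {Ω : Type*} {m : MeasurableSpace Ω} {P : Measure Ω}
    [IsFiniteMeasure P] {X Y Z W : MeasurableSpace Ω} (hXm : X ≤ m) (hYm : Y ≤ m) (hZm : Z ≤ m)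
    (hWZ : W ≤ Z) (hWc : zeroLambda m P ≤ W) (hZXY : Z ≤ X ⊔ Y)
    (h : ∀ A B, MeasurableSet[X] A → MeasurableSet[Y] B →
      condProb P W (A ∩ B) =ᵐ[P] condProb P Z (A ∩ B)) : Z ≤ W := by
  intro D hD
  have hWm := hWZ.trans hZm
  have hDm := hZm D hD
  have hle : X ⊔ Y ≤ m := sup_le hXm hYm
  have hDint := integrable_indicator_one P hDm
  have hset : ∀ C, MeasurableSet[X ⊔ Y] C →
      ∫ ω in C, condProb P W D ω ∂P = ∫ ω in C, D.indicator (fun _ => (1 : ℝ)) ω ∂P := by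
    refine fun C hC => setIntegral_eq_of_forall_inter (f := condProb P W D) hXm hYm
      integrable_condExp hDint (fun A B hA hB => ?_) hC
    have hAB := (hXm A hA).inter (hYm B hB)
    rw [setIntegral_condProb_comm P hWm hAB hDm,
      integral_congr_ae (ae_restrict_of_ae (h A B hA hB)),
      setIntegral_condProb_comm P hZm hDm hAB, condProb_eq_indicator_of_measurableSet P hZm hD]
  have hae : condProb P W D =ᵐ[P] D.indicator fun _ => (1 : ℝ) :=
    ae_eq_of_forall_setIntegral_eq_of_sigmaFinite' hle
      (fun _ _ _ => integrable_condExp.integrableOn) (fun _ _ _ => hDint.integrableOn)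
      (fun C hC _ => hset C hC)
      (stronglyMeasurable_condExp.mono (hWZ.trans hZXY)).aestronglyMeasurable
      (stronglyMeasurable_const.indicator (hZXY D hD)).aestronglyMeasurable
  have hDmeas : Measurable[W] (D.indicator fun _ => (1 : ℝ)) :=
    measurable_of_ae_eq_of_zeroLambda_le hWc hWm (measurable_const.indicator hDm)
      stronglyMeasurable_condExp.measurable hae.symm
  exact (measurable_indicator_const_iff (1 : ℝ)).mp hDmeas

/-- **Complements II.** For `X ⟂ Y` and `Z ⊆ X ∨ Y`: `Z = (X ∧ Z) ∨ (Y ∧ Z)` iff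
`X` and `Y` are conditionally independent given `Z` and the conditional probabilities
`P[·|Z]` of events of `Y` (resp. `X`) have `Y`-measurable (resp. `X`-measurable)
versions. -/
theorem stmt14 {Ω : Type*} {m : MeasurableSpace Ω} (P : Measure Ω) [IsProbabilityMeasure P]
    (X Y Z : MeasurableSpace Ω) (hXm : X ≤ m) (hYm : Y ≤ m) (hZm : Z ≤ m)
    (hXc : zeroLambda m P ≤ X) (hYc : zeroLambda m P ≤ Y) (hZc : zeroLambda m P ≤ Z)
    (hIndep : Indep X Y P) (hZXY : Z ≤ X ⊔ Y) :
    Z = (X ⊓ Z) ⊔ (Y ⊓ Z) ↔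
      (CondIndepPair P Z X Y ∧
        (∀ B : Set Ω, MeasurableSet[Y] B →
          ∃ g : Ω → ℝ, Measurable[Y] g ∧ condProb P Z B =ᵐ[P] g) ∧
        (∀ A : Set Ω, MeasurableSet[X] A →
          ∃ g : Ω → ℝ, Measurable[X] g ∧ condProb P Z A =ᵐ[P] g)) := by
  have hWZ : (X ⊓ Z) ⊔ (Y ⊓ Z) ≤ Z := sup_le inf_le_right inf_le_right
  constructor
  · intro hZ
    have hA : ∀ A, MeasurableSet[X] A → condProb P Z A =ᵐ[P] condProb P (X ⊓ Z) A := by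
      intro A hA
      have h := condProb_sup_ae_eq_left P hXm hYm (inf_le_left : X ⊓ Z ≤ X)
        (inf_le_left : Y ⊓ Z ≤ Y) hIndep hA
      rwa [← hZ] at h
    have hB : ∀ B, MeasurableSet[Y] B → condProb P Z B =ᵐ[P] condProb P (Y ⊓ Z) B := by
      intro B hB
      have h := condProb_sup_ae_eq_right P hXm hYm (inf_le_left : X ⊓ Z ≤ X)
        (inf_le_left : Y ⊓ Z ≤ Y) hIndep hB
      rwa [← hZ] at h
    refine ⟨fun A B hAX hBY => ?_,
      fun B hBY => ⟨_, stronglyMeasurable_condExp.measurable.mono inf_le_left le_rfl, hB B hBY⟩,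
      fun A hAX => ⟨_, stronglyMeasurable_condExp.measurable.mono inf_le_left le_rfl, hA A hAX⟩⟩
    have h := condProb_inter_sup_ae_eq_mul P hXm hYm (inf_le_left : X ⊓ Z ≤ X)
      (inf_le_left : Y ⊓ Z ≤ Y) hIndep hAX hBY
    rw [← hZ] at h
    exact h.trans ((hA A hAX).mul (hB B hBY)).symm
  · rintro ⟨hCI, hY, hX⟩
    refine le_antisymm (le_of_condProb_inter_ae_eq hXm hYm hZm hWZ
      ((le_inf hXc hZc).trans le_sup_left) hZXY fun A B hA hB => ?_) hWZ
    obtain ⟨f, hf, hAf⟩ := hX A hA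
    obtain ⟨g, hg, hBg⟩ := hY B hB
    have hfW := (measurable_inf_of_condProb_ae_eq hXm hZm hZc hf hAf).mono
      (le_sup_left : X ⊓ Z ≤ (X ⊓ Z) ⊔ (Y ⊓ Z)) le_rfl
    have hgW := (measurable_inf_of_condProb_ae_eq hYm hZm hZc hg hBg).mono
      (le_sup_right : Y ⊓ Z ≤ (X ⊓ Z) ⊔ (Y ⊓ Z)) le_rfl
    exact condProb_ae_eq_of_le_of_ae_eq_measurable hWZ hZm (hfW.mul hgW)
      ((hCI A B hA hB).trans (hAf.mul hBg))
end
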